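/- arXiv:2504.09615 — 2 statements merged into one kernel-verified Lean document; each statement's English description precedes it below -/
import Mathlib

section
/- For every polynomial t ∈ ℚ[X], evaluating the polynomial ℳ(t) at the rational function ŷ/1̂ ∈ ℚ(y) yields t̂/1̂; that is, ℳ(t)(ŷ/1̂) = t̂/1̂ in ℚ(y). Here ŷ/1̂ = y²/(y−1), where ŷ is the hat transform of the polynomial X (i.e. of y) and 1̂ = 1 − 1/(y−1) is the hat transform of the constant polynomial 1. -/
open Polynomial

/-- The formula for `ℳ(Xⁿ) = ∑_{k=0}^{⌊n/2⌋} (−1)^k · C(n−k, k) · X^{n−k}`. -/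
noncomputable def Mform (n : ℕ) : Polynomial ℚ :=
  ∑ k ∈ Finset.range (n / 2 + 1),
    Polynomial.C ((-1 : ℚ) ^ k * (Nat.choose (n - k) k : ℚ)) * Polynomial.X ^ (n - k)

/-- The generator `y` of the field of rational functions `ℚ(y)`. -/
noncomputable def yR : RatFunc ℚ := RatFunc.X

/-- The hat transform `t̂ = t(y) − (1/(y−1)) · t(y/(y−1)) ∈ ℚ(y)` of a polynomial `t`. -/
noncomputable def hatY (t : Polynomial ℚ) : RatFunc ℚ :=
  Polynomial.aeval yR t - (1 / (yR - 1)) * Polynomial.aeval (yR / (yR - 1)) t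

theorem Mform_eq_sum_antidiagonal (n : ℕ) :
    Mform n = ∑ p ∈ Finset.HasAntidiagonal.antidiagonal n,
      C ((-1 : ℚ) ^ p.2 * (Nat.choose p.1 p.2 : ℚ)) * X ^ p.1 := by
  rw [← Finset.Nat.sum_antidiagonal_swap]
  simp only [Prod.fst_swap, Prod.snd_swap]
  rw [Finset.Nat.sum_antidiagonal_eq_sum_range_succ
    (fun j i => C ((-1 : ℚ) ^ j * (Nat.choose i j : ℚ)) * X ^ i), Mform]
  refine Finset.sum_subset (Finset.range_mono (by omega)) fun k hk hk' => ?_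
  rw [Finset.mem_range] at hk hk'
  rw [Nat.choose_eq_zero_of_lt (by omega)]
  simp

theorem Mform_add_two (n : ℕ) : Mform (n + 2) = X * Mform (n + 1) - X * Mform n := by
  simp only [Mform_eq_sum_antidiagonal]
  rw [Finset.Nat.antidiagonal_succ_succ', Finset.Nat.antidiagonal_succ']
  simp only [Finset.sum_cons, Finset.sum_map, mul_add, Finset.mul_sum, Function.Embedding.prodMap,
    Function.Embedding.coeFn_mk, Prod.map, Function.Embedding.refl_apply,
    Nat.choose_succ_succ, Nat.succ_eq_add_one]
  rw [add_sub_assoc, ← Finset.sum_sub_distrib]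
  simp only [Nat.choose_zero_right, Nat.choose_zero_succ, pow_zero, Nat.cast_one, Nat.cast_zero,
    mul_one, mul_zero, map_one, map_zero, zero_add, one_mul]
  congr 1
  · ring
  · refine Finset.sum_congr rfl fun p _ => ?_
    push_cast
    simp only [map_mul, map_add, map_pow, map_neg, map_one]
    ring

/-- If `a + b = a * b`, then `ℳ(Xⁿ)` at `a + b` is the complete homogeneous symmetric polynomial of
degree `n` in `a` and `b`. -/
theorem sub_mul_aeval_Mform {A : Type*} [CommRing A] [Algebra ℚ A] {a b : A}
    (h : a + b = a * b) (n : ℕ) :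
    (a - b) * aeval (a + b) (Mform n) = a ^ (n + 1) - b ^ (n + 1) := by
  induction n using Nat.twoStepInduction with
  | zero => simp [Mform]
  | one => simp [Mform]; ring
  | more n ih₀ ih₁ =>
    rw [Mform_add_two, map_sub, map_mul, map_mul, aeval_X]
    linear_combination (a + b) * ih₁ - (a + b) * ih₀ - (a ^ (n + 1) - b ^ (n + 1)) * h

theorem yR_sub_C_ne_zero (c : ℚ) : yR - RatFunc.C c ≠ 0 := by
  rw [yR, ← RatFunc.algebraMap_X, ← RatFunc.algebraMap_C, ← map_sub]
  exact RatFunc.algebraMap_ne_zero (X_sub_C_ne_zero c)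

theorem hatY_C_mul (c : ℚ) (t : ℚ[X]) :
    hatY (C c * t) = algebraMap ℚ (RatFunc ℚ) c * hatY t := by
  simp only [hatY, map_mul, aeval_C]
  ring

theorem hatY_add (s t : ℚ[X]) : hatY (s + t) = hatY s + hatY t := by
  simp only [hatY, map_add]
  ring

/-- For every polynomial `t`, evaluating `ℳ(t)` at `ŷ/1̂ = y²/(y−1)` yields `t̂/1̂`. -/
theorem M_aeval_hat (M : Polynomial ℚ →ₗ[ℚ] Polynomial ℚ)
    (hM : ∀ n : ℕ, M (Polynomial.X ^ n) = Mform n)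
    (t : Polynomial ℚ) :
    Polynomial.aeval (hatY Polynomial.X / hatY 1) (M t) = hatY t / hatY 1 := by
  have h0 : yR ≠ 0 := by simpa using yR_sub_C_ne_zero 0
  have h1 : yR - 1 ≠ 0 := by simpa using yR_sub_C_ne_zero 1
  have h2 : yR - 2 ≠ 0 := by simpa using yR_sub_C_ne_zero 2
  have hone : hatY 1 = (yR - 2) / (yR - 1) := by
    simp only [hatY, map_one]
    field_simp
    ring
  have hquot : hatY X / hatY 1 = yR + yR / (yR - 1) := by
    rw [hone]
    simp only [hatY, aeval_X]
    field_simp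
    ring
  have hsum : yR + yR / (yR - 1) = yR * (yR / (yR - 1)) := by
    field_simp
    ring
  have hdiff : yR - yR / (yR - 1) = yR * hatY 1 := by
    rw [hone]
    field_simp
    ring
  have hone0 : hatY 1 ≠ 0 := by
    rw [hone]
    exact div_ne_zero h2 h1
  rw [hquot]
  induction t using Polynomial.induction_on' with
  | add p q hp hq => rw [map_add, map_add, hp, hq, hatY_add, add_div]
  | monomial n c =>
    rw [← C_mul_X_pow_eq_monomial, hatY_C_mul, ← smul_eq_C_mul, map_smul, hM, smul_eq_C_mul,
      map_mul, aeval_C, mul_div_assoc]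
    congr 1
    have key := sub_mul_aeval_Mform hsum n
    rw [hdiff] at key
    rw [eq_div_iff hone0]
    apply mul_left_cancel₀ h0
    simp only [hatY, map_pow, aeval_X] at key ⊢
    linear_combination key
end

section
/- For every polynomial m ∈ ℚ[X], evaluating the polynomial 𝒯(m) at the Laurent series x̂/1̂ ∈ ℚ((u)) yields m̂/1̂; that is, 𝒯(m)(x̂/1̂) = m̂/1̂ in ℚ((u)), where x̂ is the hat transform of the polynomial X (i.e. of x) and 1̂ = 1/(2s) + 1/2 is the hat transform of the constant polynomial 1. -/
open Polynomial

/-- The formula for `𝒯(Xⁿ) = ∑_{k=1}^{n} (k/(2n−k)) · C(2n−k, n−k) · X^k` (for `n ≥ 1`). -/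
noncomputable def Tform (n : ℕ) : Polynomial ℚ :=
  ∑ k ∈ Finset.Icc 1 n,
    Polynomial.C ((k : ℚ) / ((2 * n - k : ℕ) : ℚ) * (Nat.choose (2 * n - k) (n - k) : ℚ)) *
      Polynomial.X ^ k

/-- The Laurent series `m(u⁻¹)` associated to a polynomial `m` (thinking of `u` as `x⁻¹`). -/
noncomputable def polyInv (m : Polynomial ℚ) : LaurentSeries ℚ :=
  m.sum fun i a => HahnSeries.single (-(i : ℤ)) a

/-- Truncation `[f]` of a Laurent series in `u` to the terms with exponents `≤ 0` in `u`
(i.e. the terms with nonnegative powers of `x = u⁻¹`). -/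
noncomputable def truncNonpos (f : LaurentSeries ℚ) : LaurentSeries ℚ where
  coeff n := if n ≤ 0 then f.coeff n else 0
  isPWO_support' := f.isPWO_support'.mono (by
    intro n hn
    simp only [Function.mem_support, ne_eq] at hn ⊢
    intro h
    apply hn
    split <;> simp [h])

/-- The power series `s = 1 − 2·∑_{n≥1} catalan(n−1) uⁿ`, the unique power series with
constant term `1` whose square is `1 − 4u` (it represents `√(1 − 4/x)`). -/
noncomputable def sSeries : PowerSeries ℚ :=
  1 - 2 * PowerSeries.mk fun n => if n = 0 then 0 else (catalan (n - 1) : ℚ)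

/-- `s` viewed as a Laurent series. -/
noncomputable def sL : LaurentSeries ℚ := HahnSeries.ofPowerSeries ℤ ℚ sSeries

/-- The hat transform `m̂ = (1/s)·[m(u⁻¹)·s/2] + m(u⁻¹)/2 ∈ ℚ((u))` of a polynomial `m`. -/
noncomputable def hatX (m : Polynomial ℚ) : LaurentSeries ℚ :=
  (1 / sL) * truncNonpos (polyInv m * sL / 2) + polyInv m / 2

theorem coeff_Tform (n k : ℕ) : (Tform n).coeff k =
    if k ≤ n then (k : ℚ) / ((2 * n - k : ℕ) : ℚ) * (Nat.choose (2 * n - k) (n - k) : ℚ)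
    else 0 := by
  simp only [Tform, finsetSum_coeff, coeff_C_mul, coeff_X_pow, mul_ite, mul_one, mul_zero,
    Finset.sum_ite_eq, Finset.mem_Icc]
  rcases Nat.eq_zero_or_pos k with rfl | hk
  · simp
  · simp [Nat.one_le_iff_ne_zero, hk.ne']

theorem coeff_Tform_add (k m : ℕ) : (Tform (k + m)).coeff k =
    (k : ℚ) / (2 * m + k) * (Nat.choose (2 * m + k) m : ℚ) := by
  rw [coeff_Tform, if_pos (by omega), show 2 * (k + m) - k = 2 * m + k by omega,
    Nat.add_sub_cancel_left]
  push_cast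
  rfl

theorem coeff_Tform_self {n : ℕ} (hn : n ≠ 0) : (Tform n).coeff n = 1 := by
  have := coeff_Tform_add n 0
  simpa [hn] using this

theorem coeff_Tform_of_lt {n k : ℕ} (h : n < k) : (Tform n).coeff k = 0 := by
  rw [coeff_Tform, if_neg (by omega)]

theorem coeff_Tform_zero (n : ℕ) : (Tform n).coeff 0 = 0 := by
  simp [coeff_Tform]

theorem coeff_Tform_succ_one (n : ℕ) : (Tform (n + 1)).coeff 1 = (catalan n : ℚ) := by
  rw [add_comm n 1, coeff_Tform_add]
  have h1 := succ_mul_catalan_eq_centralBinom n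
  have h2 := Nat.choose_mul_succ_eq (2 * n) n
  rw [← Nat.centralBinom_eq_two_mul_choose, ← h1, show 2 * n + 1 - n = n + 1 by omega] at h2
  have h3 : catalan n * (2 * n + 1) = (2 * n + 1).choose n :=
    Nat.eq_of_mul_eq_mul_right (Nat.succ_pos n) (by rw [Nat.succ_eq_add_one, ← h2]; ring)
  rw [← h3]
  push_cast
  field_simp

/-- The ballot recurrence for the coefficients of `Tform`. -/
theorem coeff_Tform_recurrence {n : ℕ} (hn : n ≠ 0) (k : ℕ) :
    (Tform n).coeff k + (Tform (n + 1)).coeff (k + 2) = (Tform (n + 1)).coeff (k + 1) := by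
  rcases lt_trichotomy n k with h | rfl | h
  · simp [coeff_Tform_of_lt h, coeff_Tform_of_lt (show n + 1 < k + 2 by omega),
      coeff_Tform_of_lt (show n + 1 < k + 1 by omega)]
  · simp [coeff_Tform_self hn, coeff_Tform_of_lt (show n + 1 < n + 2 by omega), coeff_Tform_self]
  · obtain ⟨m, rfl⟩ := Nat.exists_eq_add_of_lt h
    have e1 := coeff_Tform_add k (m + 1)
    have e2 := coeff_Tform_add (k + 2) m
    have e3 := coeff_Tform_add (k + 1) (m + 1)
    rw [show k + 2 + m = k + m + 1 + 1 by ring] at e2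
    rw [show k + 1 + (m + 1) = k + m + 1 + 1 by ring] at e3
    rw [← add_assoc] at e1
    rw [e1, e2, e3]
    rw [show 2 * (m + 1) + k = 2 * m + (k + 2) by ring,
      show 2 * (m + 1) + (k + 1) = 2 * m + (k + 2) + 1 by ring, Nat.choose_succ_succ]
    have h := Nat.choose_succ_right_eq (2 * m + (k + 2)) m
    rw [show 2 * m + (k + 2) - m = m + k + 2 by omega] at h
    have hq : ((2 * m + (k + 2)).choose (m + 1) : ℚ) =
        ((2 * m + (k + 2)).choose m : ℚ) * (m + k + 2) / (m + 1) := by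
      rw [eq_div_iff (by positivity)]
      exact_mod_cast h
    push_cast
    rw [hq]
    have h1 : (2 * (m + 1) + k : ℚ) ≠ 0 := by positivity
    have h2 : (2 * m + (k + 2) : ℚ) ≠ 0 := by positivity
    have h3 : (2 * (m + 1) + (k + 1) : ℚ) ≠ 0 := by positivity
    field_simp
    ring

theorem Tform_recurrence {n : ℕ} (hn : n ≠ 0) :
    X ^ 2 * Tform n + Tform (n + 1) = X * Tform (n + 1) + C (catalan n : ℚ) * X := by
  ext j
  rw [sq, mul_assoc]
  rcases j with _ | _ | k
  · simp [coeff_Tform_zero]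
  · simp [coeff_Tform_succ_one, coeff_Tform_zero]
  · simpa [coeff_X] using coeff_Tform_recurrence hn k

theorem Tform_one : Tform 1 = X := by
  simp [Tform]

theorem algebraMap_laurentSeries (c : ℚ) :
    algebraMap ℚ (LaurentSeries ℚ) c = HahnSeries.C c :=
  RingHom.congr_fun (Subsingleton.elim _ _) c

theorem polyInv_eq_aeval (m : ℚ[X]) :
    polyInv m = aeval (HahnSeries.single (-1 : ℤ) (1 : ℚ) : LaurentSeries ℚ) m := by
  rw [aeval_def, eval₂_eq_sum, polyInv]
  refine congrArg m.sum (funext₂ fun i a => ?_)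
  simp [HahnSeries.single_pow, -eq_ratCast, algebraMap_laurentSeries]

theorem truncNonpos_add (f g : LaurentSeries ℚ) :
    truncNonpos (f + g) = truncNonpos f + truncNonpos g := by
  ext n
  simp only [truncNonpos, HahnSeries.coeff_add]
  split <;> simp

theorem truncNonpos_C_mul (c : ℚ) (f : LaurentSeries ℚ) :
    truncNonpos (HahnSeries.C c * f) = HahnSeries.C c * truncNonpos f := by
  ext n
  simp only [truncNonpos, HahnSeries.C_mul_eq_smul, HahnSeries.coeff_smul, smul_ite, smul_zero]

theorem truncNonpos_single_mul (f : LaurentSeries ℚ) :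
    truncNonpos (HahnSeries.single (-1) 1 * f) =
      HahnSeries.single (-1) 1 * truncNonpos f + HahnSeries.C (f.coeff 1) := by
  ext n
  simp only [truncNonpos, HahnSeries.coeff_add, HahnSeries.coeff_single_mul, HahnSeries.C_apply,
    HahnSeries.coeff_single, one_mul, sub_neg_eq_add]
  rcases lt_trichotomy n 0 with h | rfl | h
  · rw [if_pos h.le, if_pos (by omega), if_neg h.ne, add_zero]
  · simp
  · rw [if_neg (by omega), if_neg (by omega), if_neg h.ne', add_zero]

theorem hatX_add (p q : ℚ[X]) : hatX (p + q) = hatX p + hatX q := by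
  simp only [hatX, polyInv_eq_aeval, map_add, add_mul, add_div, truncNonpos_add, mul_add]
  ring

theorem hatX_C_mul (c : ℚ) (p : ℚ[X]) : hatX (C c * p) = HahnSeries.C c * hatX p := by
  simp only [hatX, polyInv_eq_aeval, map_mul, aeval_C, algebraMap_laurentSeries, mul_assoc,
    mul_div_assoc, truncNonpos_C_mul]
  ring

/-- The Laurent series `(1 - s) / 2 = ∑_{n ≥ 1} catalan (n - 1) uⁿ`. -/
noncomputable def catalanL : LaurentSeries ℚ :=
  HahnSeries.ofPowerSeries ℤ ℚ
    (PowerSeries.X * PowerSeries.catalanSeries.map (Nat.castRingHom ℚ))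

theorem sL_eq : sL = 1 - 2 * catalanL := by
  have h : (PowerSeries.mk fun n => if n = 0 then 0 else (catalan (n - 1) : ℚ)) =
      PowerSeries.X * PowerSeries.catalanSeries.map (Nat.castRingHom ℚ) := by
    ext (_ | n) <;> simp [PowerSeries.coeff_succ_X_mul]
  rw [sL, sSeries, h, map_sub, map_mul, map_one, map_ofNat, catalanL]

theorem laurentSeries_two_ne_zero : (2 : LaurentSeries ℚ) ≠ 0 := by
  rw [← map_ofNat HahnSeries.C]
  exact HahnSeries.C_ne_zero two_ne_zero

theorem laurentSeries_div_two (f : LaurentSeries ℚ) : f / 2 = HahnSeries.C (1 / 2 : ℚ) * f := by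
  rw [map_div₀, map_one, map_ofNat]
  ring

theorem catalanL_mul_one_sub : catalanL * (1 - catalanL) = HahnSeries.single (1 : ℤ) (1 : ℚ) := by
  have h := congrArg (PowerSeries.map (Nat.castRingHom ℚ))
    PowerSeries.catalanSeries_sq_mul_X_add_one
  simp only [map_add, map_mul, map_pow, map_one, PowerSeries.map_X] at h
  rw [← HahnSeries.ofPowerSeries_X, catalanL, ← map_one (HahnSeries.ofPowerSeries ℤ ℚ), ← map_sub,
    ← map_mul]
  congr 1
  linear_combination (-PowerSeries.X : PowerSeries ℚ) * h

theorem coeff_sL_succ (n : ℕ) : sL.coeff (n + 1 : ℤ) = -2 * (catalan n : ℚ) := by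
  have h := HahnSeries.ofPowerSeries_apply_coeff (Γ := ℤ) sSeries (n + 1)
  push_cast at h
  rw [sL, h, sSeries, map_sub, ← map_ofNat (PowerSeries.C (R := ℚ)) 2, PowerSeries.coeff_C_mul]
  simp [PowerSeries.coeff_one]

theorem coeff_sL_zero : sL.coeff 0 = 1 := by
  have h := HahnSeries.ofPowerSeries_apply_coeff (Γ := ℤ) sSeries 0
  push_cast at h
  rw [sL, h, sSeries, map_sub, ← map_ofNat (PowerSeries.C (R := ℚ)) 2, PowerSeries.coeff_C_mul,
    PowerSeries.coeff_mk]
  simp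

theorem truncNonpos_sL : truncNonpos sL = 1 := by
  ext n
  simp only [truncNonpos, HahnSeries.coeff_one]
  rcases lt_trichotomy n 0 with h | rfl | h
  · rw [if_pos h.le, if_neg h.ne, sL, PowerSeries.coeff_coe, if_pos h]
  · simp [coeff_sL_zero]
  · rw [if_neg (by omega), if_neg h.ne']

theorem sL_ne_zero : sL ≠ 0 := fun h => by simpa [h] using coeff_sL_zero


theorem hatX_one : hatX 1 = (1 - catalanL) / sL := by
  have h := sL_ne_zero
  have h2 := laurentSeries_two_ne_zero
  rw [hatX, polyInv_eq_aeval, map_one, one_mul, laurentSeries_div_two sL, truncNonpos_C_mul,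
    truncNonpos_sL, ← laurentSeries_div_two]
  field_simp
  rw [sL_eq]
  ring

theorem hatX_X_pow_succ (n : ℕ) :
    hatX (X ^ (n + 1)) = HahnSeries.single (-1) 1 * hatX (X ^ n) -
      HahnSeries.C (catalan n : ℚ) / sL := by
  have hc : (polyInv (X ^ n) * sL / 2).coeff 1 = -(catalan n : ℚ) := by
    rw [laurentSeries_div_two, polyInv_eq_aeval, map_pow, aeval_X, HahnSeries.single_pow,
      HahnSeries.C_mul_eq_smul, HahnSeries.coeff_smul, HahnSeries.coeff_single_mul]
    have : (1 - n • (-1) : ℤ) = n + 1 := by simp; ring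
    rw [this, coeff_sL_succ]
    simp
  have hp : polyInv (X ^ (n + 1)) = HahnSeries.single (-1) 1 * polyInv (X ^ n) := by
    simp only [polyInv_eq_aeval, pow_succ', map_mul, aeval_X]
  rw [hatX, hp, mul_assoc, mul_div_assoc, truncNonpos_single_mul, hc, hatX, map_neg]
  ring

theorem catalanL_mul_one_sub_ne_zero : catalanL * (1 - catalanL) ≠ 0 := by
  rw [catalanL_mul_one_sub]
  exact HahnSeries.single_ne_zero one_ne_zero

theorem catalanL_ne_zero : catalanL ≠ 0 :=
  left_ne_zero_of_mul catalanL_mul_one_sub_ne_zero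

theorem one_sub_catalanL_ne_zero : 1 - catalanL ≠ 0 :=
  right_ne_zero_of_mul catalanL_mul_one_sub_ne_zero

theorem hatX_one_ne_zero : hatX 1 ≠ 0 := by
  rw [hatX_one]
  exact div_ne_zero one_sub_catalanL_ne_zero sL_ne_zero

theorem single_neg_one_eq :
    (HahnSeries.single (-1 : ℤ) (1 : ℚ) : LaurentSeries ℚ) = 1 / (catalanL * (1 - catalanL)) := by
  rw [catalanL_mul_one_sub, eq_div_iff (by simp), HahnSeries.single_mul_single]
  simp

theorem hatX_X_pow_succ_div (n : ℕ) :
    hatX (X ^ (n + 1)) / hatX 1 = (hatX (X ^ n) / hatX 1) / (catalanL * (1 - catalanL)) -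
      HahnSeries.C (catalan n : ℚ) / (1 - catalanL) := by
  have h1 := sL_ne_zero
  have h2 := catalanL_ne_zero
  have h3 := one_sub_catalanL_ne_zero
  rw [hatX_X_pow_succ, single_neg_one_eq, hatX_one]
  field_simp

theorem hatX_X_div_hatX_one : hatX X / hatX 1 = 1 / catalanL := by
  have h := hatX_X_pow_succ_div 0
  have h2 := catalanL_ne_zero
  have h3 := one_sub_catalanL_ne_zero
  simp only [zero_add, pow_one, pow_zero, div_self hatX_one_ne_zero, catalan_zero,
    Nat.cast_one, map_one] at h
  rw [h]
  field_simp

theorem aeval_Tform_succ (n : ℕ) :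
    aeval (1 / catalanL) (Tform (n + 1)) = hatX (X ^ (n + 1)) / hatX 1 := by
  induction n with
  | zero => simp [Tform_one, hatX_X_div_hatX_one]
  | succ n ih =>
    have h2 := catalanL_ne_zero
    have h3 := one_sub_catalanL_ne_zero
    have h := congrArg (aeval (1 / catalanL)) (Tform_recurrence n.succ_ne_zero)
    simp only [map_add, map_mul, map_pow, aeval_X, aeval_C, algebraMap_laurentSeries,
      Nat.succ_eq_add_one, ih] at h
    rw [hatX_X_pow_succ_div]
    field_simp at h ⊢
    linear_combination -h

/-- For every polynomial `m`, evaluating `𝒯(m)` at `x̂/1̂` yields `m̂/1̂` in `ℚ((u))`. -/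
theorem T_aeval_hat (T : Polynomial ℚ →ₗ[ℚ] Polynomial ℚ)
    (hT1 : T 1 = 1)
    (hTn : ∀ n : ℕ, 1 ≤ n → T (Polynomial.X ^ n) = Tform n)
    (m : Polynomial ℚ) :
    Polynomial.aeval (hatX Polynomial.X / hatX 1) (T m) = hatX m / hatX 1 := by
  rw [hatX_X_div_hatX_one]
  induction m using Polynomial.induction_on' with
  | add p q hp hq => rw [map_add, map_add, hp, hq, hatX_add, add_div]
  | monomial n a =>
    rw [← smul_X_eq_monomial, map_smul, smul_eq_C_mul, smul_eq_C_mul, hatX_C_mul, map_mul, aeval_C,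
      algebraMap_laurentSeries, mul_div_assoc]
    congr 1
    cases n with
    | zero =>
      rw [pow_zero, hT1, map_one, div_self hatX_one_ne_zero]
    | succ n => rw [hTn _ n.succ_pos, aeval_Tform_succ]
end
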